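/- If Λ = (λ_1,…,λ_n), λ_i ∈ ℝ^k, is weakly hyperbolic, then 0 is a regular value of the defining equations of Z(Λ) on the unit sphere: for every x ∈ Z(Λ), the ℝ-linear map ℝ^n → ℝ^k × ℝ given by v ↦ (∑_{i=1}^n 2 x_i v_i λ_i, ∑_{i=1}^n 2 x_i v_i) is surjective. -/

import Mathlib

open scoped BigOperators

/-- The intersection of quadrics `Z(Λ)` for a configuration `Λ` of vectors in `ℝ^k`. -/
def ZReal {n k : ℕ} (Λ : Fin n → Fin k → ℝ) : Set (Fin n → ℝ) :=
  {x | (∑ i, (x i) ^ 2 • Λ i) = 0 ∧ (∑ i, (x i) ^ 2) = 1}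

/-- `Λ` is weakly hyperbolic: for every subset `J` with at most `k` elements,
the origin is not in the convex hull of the `λ_i`, `i ∈ J`. -/
def WeaklyHyperbolic {n k : ℕ} (Λ : Fin n → Fin k → ℝ) : Prop :=
  ∀ J : Finset (Fin n), J.card ≤ k → (0 : Fin k → ℝ) ∉ convexHull ℝ (Λ '' ↑J)

/-- The derivative at `x` of `x ↦ (∑ xᵢ² λᵢ, ∑ xᵢ²)`, as a linear map. -/
def quadricDerivative {n k : ℕ} (Λ : Fin n → Fin k → ℝ) (x : Fin n → ℝ) :
    (Fin n → ℝ) →ₗ[ℝ] (Fin k → ℝ) × ℝ :=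
  ∑ i, (LinearMap.proj i : (Fin n → ℝ) →ₗ[ℝ] ℝ).smulRight ((2 * x i) • (Λ i, (1 : ℝ)))

theorem quadricDerivative_apply {n k : ℕ} (Λ : Fin n → Fin k → ℝ) (x v : Fin n → ℝ) :
    quadricDerivative Λ x v = (∑ i, (2 * x i * v i) • Λ i, ∑ i, 2 * x i * v i) := by
  simp [quadricDerivative, LinearMap.sum_apply, Prod.ext_iff, Prod.fst_sum, Prod.snd_sum,
    smul_smul, mul_comm]

/-- For a point of `Z(Λ)`, the origin is in the convex hull of the `λᵢ` with `xᵢ ≠ 0`. -/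
theorem zero_mem_convexHull_of_mem_ZReal {n k : ℕ} {Λ : Fin n → Fin k → ℝ} {x : Fin n → ℝ}
    (hx : x ∈ ZReal Λ) : (0 : Fin k → ℝ) ∈ convexHull ℝ (Λ '' {i | x i ≠ 0}) := by
  classical
  have hsum : ∑ i with x i ≠ 0, (x i) ^ 2 = 1 := by
    rw [← hx.2]
    exact Finset.sum_filter_of_ne fun i _ h hi => h (by simp [hi])
  have hzero : ∑ i with x i ≠ 0, (x i) ^ 2 • Λ i = 0 := by
    rw [← hx.1]
    exact Finset.sum_filter_of_ne fun i _ h hi => h (by simp [hi])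
  rw [← hzero]
  refine (convex_convexHull ℝ _).sum_mem (fun i _ => sq_nonneg _) hsum fun i hi => ?_
  exact subset_convexHull ℝ _ ⟨i, by simpa using hi, rfl⟩

/-- A family of `λᵢ` whose convex hull contains the origin spans `ℝ^k` if `Λ` is weakly
hyperbolic. -/
theorem WeaklyHyperbolic.span_eq_top {n k : ℕ} {Λ : Fin n → Fin k → ℝ}
    (hΛ : WeaklyHyperbolic Λ) {I : Set (Fin n)}
    (h0 : (0 : Fin k → ℝ) ∈ convexHull ℝ (Λ '' I)) : Submodule.span ℝ (Λ '' I) = ⊤ := by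
  classical
  obtain ⟨ι, _, z, w, hz, hind, hw, hw1, hwz⟩ := eq_pos_convex_span_of_mem_convexHull h0
  choose f hfI hf using fun j => hz ⟨j, rfl⟩
  have hcard : k < Fintype.card ι := by
    by_contra! hle
    refine hΛ (Finset.univ.image f) (Finset.card_image_le.trans hle) ?_
    rw [← hwz]
    refine (convex_convexHull ℝ _).sum_mem (fun j _ => (hw j).le) hw1 fun j _ => ?_
    exact subset_convexHull ℝ _ ⟨f j, by simp, hf j⟩
  have hcard_eq : Fintype.card ι = Module.finrank ℝ (Fin k → ℝ) + 1 := by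
    have hle := hind.card_le_finrank_succ.trans
      (Nat.add_le_add_right (Submodule.finrank_le _) 1)
    rw [Module.finrank_fin_fun] at hle ⊢
    omega
  have htop := hind.affineSpan_eq_top_iff_card_eq_finrank_add_one.2 hcard_eq
  refine top_unique fun a _ => Submodule.span_mono hz (affineSpan_subset_span ?_)
  rw [htop]
  trivial

/-- If `Λ` is weakly hyperbolic then `0` is a regular value of the defining equations of
`Z(Λ)` on the unit sphere: at every `x ∈ Z(Λ)`, the derivative
`v ↦ (∑ 2 xᵢ vᵢ λᵢ, ∑ 2 xᵢ vᵢ)` is surjective onto `ℝ^k × ℝ`. -/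
theorem regular_value_real {n k : ℕ} (hn : 1 ≤ n) (hk : 1 ≤ k)
    (Λ : Fin n → Fin k → ℝ) (hΛ : WeaklyHyperbolic Λ)
    (x : Fin n → ℝ) (hx : x ∈ ZReal Λ) :
    Function.Surjective (fun v : Fin n → ℝ =>
      ((∑ i, (2 * x i * v i) • Λ i, ∑ i, 2 * x i * v i) : (Fin k → ℝ) × ℝ)) := by
  rw [show (fun v : Fin n → ℝ =>
      ((∑ i, (2 * x i * v i) • Λ i, ∑ i, 2 * x i * v i) : (Fin k → ℝ) × ℝ)) =
      quadricDerivative Λ x from funext fun v => (quadricDerivative_apply Λ x v).symm]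
  have hvert : ((0 : Fin k → ℝ), (1 : ℝ)) ∈ LinearMap.range (quadricDerivative Λ x) := by
    refine ⟨fun i => x i / 2, ?_⟩
    have hsq : ∀ i, 2 * x i * (x i / 2) = x i ^ 2 := fun i => by ring
    simp only [quadricDerivative_apply, hsq, hx.1, hx.2]
  have hhor : Submodule.span ℝ (Λ '' {i | x i ≠ 0}) ≤
      (LinearMap.range (quadricDerivative Λ x)).comap (LinearMap.inl ℝ (Fin k → ℝ) ℝ) := by
    rw [Submodule.span_le]
    rintro _ ⟨i, hi, rfl⟩
    have hcol : (Λ i, (1 : ℝ)) ∈ LinearMap.range (quadricDerivative Λ x) := by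
      refine ⟨Pi.single i (2 * x i)⁻¹, ?_⟩
      have hne : 2 * x i ≠ 0 := mul_ne_zero two_ne_zero hi
      rw [quadricDerivative_apply, Finset.sum_eq_single i, Finset.sum_eq_single i]
      · rw [Pi.single_eq_same, mul_inv_cancel₀ hne, one_smul]
      all_goals simp +contextual
    simpa using Submodule.sub_mem _ hcol hvert
  rw [hΛ.span_eq_top (zero_mem_convexHull_of_mem_ZReal hx)] at hhor
  rintro ⟨a, b⟩
  have hab := Submodule.add_mem _ (Submodule.mem_comap.1 (hhor (Submodule.mem_top (x := a))))
    (Submodule.smul_mem _ b hvert)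
  simpa using hab
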